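/- Let ε > 0 and let f : ℝ^d → ℝ^d be a Borel measurable function with bounded range, and let P be the uniform-ball perturbation kernel associated to f and ε. Then the set of ergodic invariant probability measures of P, i.e. the set of extreme points of the convex set of all invariant probability measures of P, is finite. -/

import Mathlib

open MeasureTheory Metric Set
open scoped ENNReal
open ProbabilityTheory

section Invariant

variable {α : Type*} [MeasurableSpace α] {κ : Kernel α α} {μ ν : Measure α}

lemma ProbabilityTheory.Kernel.Invariant.smul (h : κ.Invariant μ) (c : ℝ≥0∞) :
    κ.Invariant (c • μ) := by
  rw [Kernel.Invariant, Measure.comp_smul, h.def]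

lemma ProbabilityTheory.Kernel.Invariant.sub [IsFiniteMeasure ν] (hμ : κ.Invariant μ)
    (hν : κ.Invariant ν) (hle : ν ≤ μ) : κ.Invariant (μ - ν) := by
  have hadd : (μ - ν).bind κ + ν = μ := by
    calc (μ - ν).bind κ + ν = (μ - ν).bind κ + ν.bind κ := by rw [hν.def]
      _ = μ := by rw [← Measure.comp_add, Measure.sub_add_cancel_of_le hle, hμ.def]
  ext s hs
  have h : ((μ - ν).bind κ + ν) s = (μ - ν + ν) s := by
    rw [hadd, Measure.sub_add_cancel_of_le hle]
  simpa using (ENNReal.add_left_inj (measure_ne_top ν s)).1 h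

/-- The largest common lower bound of two invariant finite measures of a Markov kernel is
invariant. -/
lemma ProbabilityTheory.Kernel.Invariant.inf [IsMarkovKernel κ] [IsFiniteMeasure μ]
    (hμ : κ.Invariant μ) (hν : κ.Invariant ν) : κ.Invariant (μ ⊓ ν) := by
  have hfin : IsFiniteMeasure (μ ⊓ ν) := isFiniteMeasure_of_le μ inf_le_left
  have hmono {ρ σ : Measure α} (h : ρ ≤ σ) : ρ.bind κ ≤ σ.bind κ := by
    refine Measure.le_iff.2 fun s hs ↦ ?_
    rw [Measure.bind_apply hs κ.aemeasurable, Measure.bind_apply hs κ.aemeasurable]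
    exact lintegral_mono' h le_rfl
  refine Measure.eq_of_le_of_measure_univ_eq (le_inf ?_ ?_) ?_
  · exact (hmono inf_le_left).trans_eq hμ
  · exact (hmono inf_le_right).trans_eq hν
  · simp [Measure.bind_apply .univ κ.aemeasurable]

/-- An extreme invariant probability measure is the normalization of every nonzero invariant
measure that it dominates. -/
lemma inv_smul_eq_of_le_of_mem_extremePoints
    (hμ : μ ∈ extremePoints ℝ≥0∞ {ρ : Measure α | IsProbabilityMeasure ρ ∧ κ.Invariant ρ})
    (hν : κ.Invariant ν) (hle : ν ≤ μ) (h0 : ν ≠ 0) : (ν univ)⁻¹ • ν = μ := by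
  obtain ⟨⟨hprob, hinv⟩, hext⟩ := hμ
  have hfin : IsFiniteMeasure ν := isFiniteMeasure_of_le μ hle
  have hmass : (μ - ν) univ + ν univ = 1 := by
    rw [← Measure.add_apply, Measure.sub_add_cancel_of_le hle, measure_univ]
  have hν0 : ν univ ≠ 0 := by simpa using h0
  have hνtop : ν univ ≠ ∞ := measure_ne_top ν univ
  by_cases hr : (μ - ν) univ = 0
  · have h := Measure.sub_add_cancel_of_le hle
    rw [Measure.measure_univ_eq_zero.1 hr, zero_add] at h
    simp [h]
  · have hrtop : (μ - ν) univ ≠ ∞ := measure_ne_top _ _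
    refine hext (x₁ := (ν univ)⁻¹ • ν) ⟨⟨?_⟩, hν.smul _⟩
      (x₂ := ((μ - ν) univ)⁻¹ • (μ - ν)) ⟨⟨?_⟩, (hinv.sub hν hle).smul _⟩
      ⟨ν univ, (μ - ν) univ, pos_iff_ne_zero.2 hν0, pos_iff_ne_zero.2 hr,
        by rw [add_comm, hmass], ?_⟩
    · simp [ENNReal.inv_mul_cancel hν0 hνtop]
    · rw [Measure.smul_apply, smul_eq_mul, ENNReal.inv_mul_cancel hr hrtop]
    · rw [smul_smul, smul_smul, ENNReal.mul_inv_cancel hν0 hνtop,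
        ENNReal.mul_inv_cancel hr hrtop, one_smul, one_smul, add_comm,
        Measure.sub_add_cancel_of_le hle]

/-- Distinct extreme invariant probability measures are mutually singular. -/
lemma mutuallySingular_of_mem_extremePoints [IsMarkovKernel κ]
    (hμ : μ ∈ extremePoints ℝ≥0∞ {ρ : Measure α | IsProbabilityMeasure ρ ∧ κ.Invariant ρ})
    (hν : ν ∈ extremePoints ℝ≥0∞ {ρ : Measure α | IsProbabilityMeasure ρ ∧ κ.Invariant ρ})
    (hne : μ ≠ ν) : μ ⟂ₘ ν := by
  have := hμ.1.1
  rw [Measure.mutuallySingular_iff_disjoint, disjoint_iff]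
  by_contra h0
  have hinf := Kernel.Invariant.inf hμ.1.2 hν.1.2
  exact hne ((inv_smul_eq_of_le_of_mem_extremePoints hμ hinf inf_le_left h0).symm.trans
    (inv_smul_eq_of_le_of_mem_extremePoints hν hinf inf_le_right h0))

end Invariant

section Singular

variable {α : Type*} [MeasurableSpace α] {μ ν ρ : Measure α}

lemma MeasureTheory.Measure.MutuallySingular.add_le (h : μ ⟂ₘ ν) (hμ : μ ≤ ρ) (hν : ν ≤ ρ) :
    μ + ν ≤ ρ := by
  obtain ⟨t, ht, hμt, hνt⟩ := h
  refine Measure.le_iff.2 fun s _ ↦ ?_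
  rw [← measure_inter_add_sdiff (μ := μ + ν) s ht, ← measure_inter_add_sdiff (μ := ρ) s ht]
  refine add_le_add ?_ ?_
  · rw [Measure.add_apply, measure_mono_null inter_subset_right hμt, zero_add]
    exact hν _
  · rw [Measure.add_apply, measure_mono_null (fun x hx ↦ hx.2) hνt, add_zero]
    exact hμ _

lemma sum_le_of_pairwise_mutuallySingular (s : Finset (Measure α))
    (hs : (s : Set (Measure α)).Pairwise Measure.MutuallySingular) (hle : ∀ μ ∈ s, μ ≤ ρ) :
    ∑ μ ∈ s, μ ≤ ρ ∧ ∀ ν, (∀ μ ∈ s, ν ⟂ₘ μ) → ν ⟂ₘ ∑ μ ∈ s, μ := by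
  classical
  induction s using Finset.induction_on with
  | empty => simp [Measure.zero_le]
  | insert μ s hμ ih =>
    rw [Finset.coe_insert, pairwise_insert] at hs
    obtain ⟨h1, h2⟩ := ih hs.1 fun ν hν ↦ hle ν (Finset.mem_insert_of_mem hν)
    rw [Finset.sum_insert hμ]
    refine ⟨?_, fun ν hν ↦ ?_⟩
    · refine (h2 μ fun ν hν ↦ ?_).add_le (hle μ (Finset.mem_insert_self _ _)) h1
      exact (hs.2 ν hν (ne_of_mem_of_not_mem hν hμ).symm).1
    · exact (hν μ (Finset.mem_insert_self _ _)).add_right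
        (h2 ν fun σ hσ ↦ hν σ (Finset.mem_insert_of_mem hσ))

/-- A pairwise mutually singular set of probability measures dominated by a finite measure is
finite. -/
lemma finite_of_pairwise_mutuallySingular [IsFiniteMeasure ρ] {S : Set (Measure α)}
    (hS : S.Pairwise Measure.MutuallySingular) (hprob : ∀ μ ∈ S, IsProbabilityMeasure μ)
    (hle : ∀ μ ∈ S, μ ≤ ρ) : S.Finite := by
  obtain ⟨n, hn⟩ := ENNReal.exists_nat_gt (measure_ne_top ρ univ)
  by_contra hinf
  obtain ⟨s, hsS, hcard⟩ := Set.Infinite.exists_subset_card_eq hinf n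
  have h := (sum_le_of_pairwise_mutuallySingular s (hS.mono hsS) fun μ hμ ↦ hle μ (hsS hμ)).1 univ
  have hsum : ∑ μ ∈ s, μ univ = n := by
    rw [Finset.sum_congr rfl fun μ hμ ↦ (hprob μ (hsS hμ)).measure_univ]
    simp [hcard]
  rw [Measure.finsetSum_apply, hsum] at h
  exact hn.not_ge h

end Singular

/-- The kernel sending `x` to the uniform probability measure on the ball of radius `ε` around
`f x`. -/
noncomputable def uniformBallKernel {d : ℕ}
    (f : EuclideanSpace ℝ (Fin d) → EuclideanSpace ℝ (Fin d)) (hf : Measurable f) (ε : ℝ) :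
    Kernel (EuclideanSpace ℝ (Fin d)) (EuclideanSpace ℝ (Fin d)) where
  toFun x := (volume (ball (0 : EuclideanSpace ℝ (Fin d)) ε))⁻¹ • volume.restrict (ball (f x) ε)
  measurable' := by
    refine Measure.measurable_of_measurable_coe _ fun A hA ↦ ?_
    simp only [Measure.smul_apply, Measure.restrict_apply hA, smul_eq_mul]
    refine Measurable.const_mul ?_ _
    have hT : MeasurableSet {p : EuclideanSpace ℝ (Fin d) × EuclideanSpace ℝ (Fin d) |
        p.2 ∈ A ∧ dist p.2 (f p.1) < ε} :=
      (measurable_snd hA).inter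
        (measurableSet_lt (measurable_snd.dist (hf.comp measurable_fst)) measurable_const)
    exact measurable_measure_prodMk_left hT

section UniformBall

variable {d : ℕ} {f : EuclideanSpace ℝ (Fin d) → EuclideanSpace ℝ (Fin d)} {hf : Measurable f}
  {ε : ℝ} {μ : Measure (EuclideanSpace ℝ (Fin d))}

lemma uniformBallKernel_apply (x : EuclideanSpace ℝ (Fin d)) :
    uniformBallKernel f hf ε x =
      (volume (ball (0 : EuclideanSpace ℝ (Fin d)) ε))⁻¹ • volume.restrict (ball (f x) ε) := rfl

lemma isMarkovKernel_uniformBallKernel (hε : 0 < ε) :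
    IsMarkovKernel (uniformBallKernel f hf ε) := by
  refine ⟨fun x ↦ ⟨?_⟩⟩
  rw [uniformBallKernel_apply, Measure.smul_apply, Measure.restrict_apply_univ,
    Measure.addHaar_ball_center volume (f x), smul_eq_mul]
  refine ENNReal.inv_mul_cancel ?_ ?_
  · exact (measure_ball_pos _ _ hε).ne'
  · exact measure_ball_lt_top.ne

lemma invariant_uniformBallKernel_iff :
    (uniformBallKernel f hf ε).Invariant μ ↔
      ∀ A : Set (EuclideanSpace ℝ (Fin d)), MeasurableSet A →
        μ A = ∫⁻ x, volume (A ∩ ball (f x) ε) /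
          volume (ball (0 : EuclideanSpace ℝ (Fin d)) ε) ∂μ := by
  rw [Kernel.Invariant, Measure.ext_iff]
  refine forall₂_congr fun A hA ↦ ?_
  rw [Measure.bind_apply hA (Kernel.aemeasurable _), eq_comm]
  simp only [uniformBallKernel_apply, Measure.smul_apply, Measure.restrict_apply hA, smul_eq_mul,
    ENNReal.div_eq_inv_mul]

/-- An invariant probability measure has density at most `1 / vol (B(0, ε))`, and it is carried by
the `ε`-neighborhood of the range of `f`. -/
lemma le_smul_restrict_of_invariant [IsProbabilityMeasure μ]
    (hμ : (uniformBallKernel f hf ε).Invariant μ) :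
    μ ≤ (volume (ball (0 : EuclideanSpace ℝ (Fin d)) ε))⁻¹ •
      volume.restrict (thickening ε (range f)) := by
  refine Measure.le_iff.2 fun A hA ↦ ?_
  rw [← hμ.def, Measure.bind_apply hA (Kernel.aemeasurable _)]
  refine (lintegral_mono fun x ↦ ?_).trans_eq (by rw [lintegral_const, measure_univ, mul_one])
  rw [uniformBallKernel_apply, Measure.smul_apply, Measure.smul_apply]
  gcongr
  exact ball_subset_thickening (mem_range_self x) ε

end UniformBall

/-- For `ε > 0` and a Borel measurable `f : ℝ^d → ℝ^d` with bounded range,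
the set of ergodic invariant probability measures of the uniform-ball perturbation kernel,
i.e. the extreme points of the convex set of invariant probability measures, is finite. -/
theorem ergodic_measures_finite
    (d : ℕ) (ε : ℝ) (hε : 0 < ε)
    (f : EuclideanSpace ℝ (Fin d) → EuclideanSpace ℝ (Fin d))
    (hf : Measurable f) (hb : Bornology.IsBounded (Set.range f)) :
    (Set.extremePoints ℝ≥0∞
      {μ : Measure (EuclideanSpace ℝ (Fin d)) | IsProbabilityMeasure μ ∧
        ∀ A : Set (EuclideanSpace ℝ (Fin d)), MeasurableSet A →
          μ A = ∫⁻ x, volume (A ∩ ball (f x) ε) /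
            volume (ball (0 : EuclideanSpace ℝ (Fin d)) ε) ∂μ}).Finite := by
  simp only [← invariant_uniformBallKernel_iff (hf := hf)]
  have := isMarkovKernel_uniformBallKernel (hf := hf) hε
  have : IsFiniteMeasure ((volume (ball (0 : EuclideanSpace ℝ (Fin d)) ε))⁻¹ •
      volume.restrict (thickening ε (range f))) := by
    refine ⟨?_⟩
    rw [Measure.smul_apply, Measure.restrict_apply_univ, smul_eq_mul]
    exact ENNReal.mul_lt_top (ENNReal.inv_lt_top.2 (measure_ball_pos _ _ hε))
      hb.thickening.measure_lt_top
  refine finite_of_pairwise_mutuallySingular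
    (ρ := (volume (ball (0 : EuclideanSpace ℝ (Fin d)) ε))⁻¹ •
      volume.restrict (thickening ε (range f)))
    (fun μ hμ ν hν hne ↦ mutuallySingular_of_mem_extremePoints hμ hν hne)
    (fun μ hμ ↦ hμ.1.1) fun μ hμ ↦ ?_
  have := hμ.1.1
  exact le_smul_restrict_of_invariant hμ.1.2
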